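/- Let W_S be any Coxeter group, A_S the corresponding Artin-Tits group, and X a nonempty proper subset of S. Then (W_X, W_S) satisfies Property ⋆_W if and only if (A_X, A_S) satisfies Property ⋆_A. -/

import Mathlib

namespace ArtinTits

variable {B : Type*}

/-- The alternating product `a b a b ⋯` with `m` factors, starting with `a`. -/
def altProd {G : Type*} [Monoid G] (a b : G) : ℕ → G
  | 0 => 1
  | n + 1 => a * altProd b a n

/-- The braid relations defining the Artin–Tits group of a Coxeter matrix:
`Π(σ_s, σ_t; m_{s,t}) = Π(σ_t, σ_s; m_{s,t})` whenever `m_{s,t} ≠ ∞` (here `∞` is coded by `0`). -/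
def artinRelationsSet (M : CoxeterMatrix B) : Set (FreeGroup B) :=
  {r | ∃ s t : B, M s t ≠ 0 ∧
    r = altProd (FreeGroup.of s) (FreeGroup.of t) (M s t) *
        (altProd (FreeGroup.of t) (FreeGroup.of s) (M s t))⁻¹}

/-- The Artin–Tits group of a Coxeter matrix. -/
abbrev ArtinGroup (M : CoxeterMatrix B) : Type _ := PresentedGroup (artinRelationsSet M)

/-- The standard generator `σ_s` of the Artin–Tits group. -/
def σ (M : CoxeterMatrix B) (s : B) : ArtinGroup M := PresentedGroup.of s

/-- The standard parabolic subgroup `A_X` of the Artin–Tits group. -/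
def AP (M : CoxeterMatrix B) (X : Set B) : Subgroup (ArtinGroup M) :=
  Subgroup.closure (σ M '' X)

/-- The standard parabolic subgroup `W_X` of the Coxeter group. -/
def WP (M : CoxeterMatrix B) (X : Set B) : Subgroup M.Group :=
  Subgroup.closure (M.simple '' X)

/-- A subgroup `H ≤ G` is conjugacy stable if any two elements of `H` which are conjugate
in `G` are already conjugate by an element of `H`. -/
def IsConjugacyStable {G : Type*} [Group G] (H : Subgroup G) : Prop :=
  ∀ a b : G, a ∈ H → b ∈ H → (∃ g : G, g⁻¹ * a * g = b) → ∃ h ∈ H, h⁻¹ * a * h = b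

/-- Property `⋆_W` for the pair `(W_X, W_S)`. -/
def StarW (M : CoxeterMatrix B) (X : Set B) : Prop :=
  ∀ Y₁ Y₂ : Set B, Y₁ ⊆ X → Y₂ ⊆ X → ∀ w : M.Group,
    (fun x => w⁻¹ * x * w) '' (M.simple '' Y₁) = M.simple '' Y₂ →
    ∃ v ∈ WP M X, ∀ y ∈ Y₁, v⁻¹ * M.simple y * v = w⁻¹ * M.simple y * w

/-- Property `⋆_A` for the pair `(A_X, A_S)`. -/
def StarA (M : CoxeterMatrix B) (X : Set B) : Prop :=
  ∀ Y₁ Y₂ : Set B, Y₁ ⊆ X → Y₂ ⊆ X → ∀ g : ArtinGroup M,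
    (fun x => g⁻¹ * x * g) '' (σ M '' Y₁) = σ M '' Y₂ →
    ∃ h ∈ AP M X, ∀ y ∈ Y₁, h⁻¹ * σ M y * h = g⁻¹ * σ M y * g

/-- Adjacency in the Coxeter graph: `s` and `t` are joined by an edge iff `m_{s,t} ≥ 3`
(where the value `0` codes `∞`, which also gives an edge). -/
def Adj (M : CoxeterMatrix B) (s t : B) : Prop := s ≠ t ∧ M s t ≠ 2

/-- `s` and `t` are connected by a path of the Coxeter graph staying inside `X`. -/
def ReachIn (M : CoxeterMatrix B) (X : Set B) (s t : B) : Prop :=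
  Relation.ReflTransGen (fun a b => a ∈ X ∧ b ∈ X ∧ Adj M a b) s t

/-- The Coxeter graph induced on `X` is connected. -/
def ConnectedIn (M : CoxeterMatrix B) (X : Set B) : Prop :=
  ∀ s ∈ X, ∀ t ∈ X, ReachIn M X s t

/-- The Coxeter matrix `M` restricted to `X` is of the type of the Coxeter matrix `M'`,
i.e. there is a bijection transporting one to the other. -/
def IsOfType {B' : Type*} (M : CoxeterMatrix B) (X : Set B) (M' : CoxeterMatrix B') : Prop :=
  ∃ e : X ≃ B', ∀ a b : X, M a.val b.val = M' (e a) (e b)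

/-- The Coxeter matrix of type `Bₙ` with the paper's labelling: vertices `0, …, n-1`
(representing `s_1, …, s_n`), `m_{s_1, s_2} = 4` and `m_{s_i, s_{i+1}} = 3` for `i ≥ 2`. -/
def Bmat (n : ℕ) : CoxeterMatrix (Fin n) where
  M := Matrix.of fun i j : Fin n ↦
    if i = j then 1
      else (if (i.val = 0 ∧ j.val = 1) ∨ (j.val = 0 ∧ i.val = 1) then 4
        else (if (j : ℕ) + 1 = i ∨ (i : ℕ) + 1 = j then 3 else 2))
  isSymm := by unfold Matrix.IsSymm; aesop
  diagonal := by simp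
  off_diagonal := by aesop

/-- The Coxeter matrix of type `Dₙ` with the paper's labelling: vertices `0, …, n-1`
(representing `s_1, …, s_n`), with edges `{s_1, s_3}`, `{s_2, s_3}` and `{s_i, s_{i+1}}`
for `i ≥ 3`, all labelled `3`. -/
def Dmat (n : ℕ) : CoxeterMatrix (Fin n) where
  M := Matrix.of fun i j : Fin n ↦
    if i = j then 1
      else (if (i.val = 0 ∧ j.val = 2) ∨ (j.val = 0 ∧ i.val = 2) then 3
        else (if i.val = 0 ∨ j.val = 0 then 2
          else (if (j : ℕ) + 1 = i ∨ (i : ℕ) + 1 = j then 3 else 2)))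
  isSymm := by unfold Matrix.IsSymm; aesop
  diagonal := by simp
  off_diagonal := by aesop

end ArtinTits

namespace ArtinTits

open Real in
/-- Coefficients of the (doubled) canonical bilinear form. -/
noncomputable def cc {B : Type*} (M : CoxeterMatrix B) (k i : B) : ℝ := -2 * Real.cos (Real.pi / M k i)

noncomputable def fc {B : Type*} (M : CoxeterMatrix B) (i : B) : Module.Dual ℝ (B →₀ ℝ) :=
  Finsupp.linearCombination ℝ (fun k => cc M k i)

lemma fc_single {B : Type*} (M : CoxeterMatrix B) (i j : B) :
    fc M i (Finsupp.single j 1) = cc M j i := by simp [fc]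

lemma cc_self {B : Type*} (M : CoxeterMatrix B) (i : B) : cc M i i = 2 := by simp [cc]

lemma cc_symm {B : Type*} (M : CoxeterMatrix B) (i j : B) : cc M i j = cc M j i := by
  simp [cc, M.symmetric i j]

lemma fc_self {B : Type*} (M : CoxeterMatrix B) (i : B) :
    fc M i (Finsupp.single i 1) = 2 := by rw [fc_single, cc_self]

noncomputable def rf {B : Type*} (M : CoxeterMatrix B) (i : B) : (B →₀ ℝ) ≃ₗ[ℝ] (B →₀ ℝ) :=
  Module.reflection (fc_self M i)

lemma cc_t {B : Type*} (M : CoxeterMatrix B) (i j : B) :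
    2 * Real.cos (2 * Real.pi / M i j) =
    fc M i (Finsupp.single j 1) * fc M j (Finsupp.single i 1) - 2 := by
  rw [fc_single, fc_single, cc_symm M j i, cc, mul_div_assoc, Real.cos_two_mul]; ring

lemma M_ge {B : Type*} (M : CoxeterMatrix B) {i j : B} (h : i ≠ j) (h0 : M i j ≠ 0)
    (h2 : M i j ≠ 2) : 3 ≤ M i j := by
  have := M.off_diagonal i j h
  omega

lemma sin_th_pos {m : ℕ} (hm : 3 ≤ m) : 0 < Real.sin (2 * Real.pi / m) := by
  have hm' : (3 : ℝ) ≤ m := by exact_mod_cast hm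
  have hp := Real.pi_pos
  apply Real.sin_pos_of_pos_of_lt_pi
  · positivity
  · rw [div_lt_iff₀ (by linarith)]; nlinarith

lemma rf_pow {B : Type*} (M : CoxeterMatrix B) (i j : B) :
    (rf M i * rf M j) ^ M i j = 1 := by
  by_cases hij : i = j
  · subst hij
    simp only [CoxeterMatrix.diagonal, pow_one, rf]
    ext1 z
    exact Module.involutive_reflection (fc_self M i) z
  by_cases h0 : M i j = 0
  · simp [h0]
  ext1 z
  have key := Module.reflection_mul_reflection_pow_apply (fc_self M i) (fc_self M j) (M i j) z
    _ (cc_t M i j)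
  by_cases h2 : M i j = 2
  · have e1 : fc M i (Finsupp.single j 1) = 0 := by
      rw [fc_single, cc_symm, cc, h2]; simp
    have e2 : fc M j (Finsupp.single i 1) = 0 := by
      rw [fc_single, cc, h2]; simp
    rw [h2, pow_two]
    simp only [rf, LinearEquiv.mul_apply, Module.reflection_apply, map_sub, map_smul, e1, e2,
      fc_self, LinearEquiv.coe_one, id]
    module
  have hm := M_ge M hij h0 h2
  have hs := sin_th_pos hm
  have hS := fun n : ℤ => Polynomial.Chebyshev.S_two_mul_real_cos (2 * Real.pi / (M i j : ℝ)) n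
  change ((rf M i * rf M j) ^ M i j) z = z
  rw [rf, rf, key]
  generalize hmm : M i j = m at *
  have hm0 : (m : ℝ) ≠ 0 := by exact_mod_cast h0
  rcases Nat.even_or_odd' m with ⟨k, rfl | rfl⟩
  · have i1 : (((2 * k : ℕ) : ℤ) - 2) / 2 = k - 1 := by omega
    have i2 : (((2 * k : ℕ) : ℤ) - 1) / 2 = k - 1 := by omega
    rw [i1, i2]
    have hz : (Polynomial.Chebyshev.S ℝ ((k : ℤ) - 1)).eval (2 * Real.cos (2 * Real.pi / ((2 * k : ℕ) : ℝ))) = 0 := by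
      have := hS (k - 1)
      have e : (((k : ℤ) - 1 : ℤ) + 1 : ℝ) * (2 * Real.pi / ((2 * k : ℕ) : ℝ)) = Real.pi := by
        push_cast at hm0 ⊢
        have hk0 : (k : ℝ) ≠ 0 := by
          intro h; simp [h] at hm0
        field_simp
        try ring
      rw [e, Real.sin_pi] at this
      exact (mul_eq_zero.mp this).resolve_right hs.ne'
    rw [hz]; simp
  · have i1 : (((2 * k + 1 : ℕ) : ℤ) - 2) / 2 = k - 1 := by omega
    have i2 : (((2 * k + 1 : ℕ) : ℤ) - 1) / 2 = k := by omega
    have i3 : (((2 * k + 1 : ℕ) : ℤ) - 3) / 2 = k - 1 := by omega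
    have i4 : (((2 * k + 1 : ℕ) : ℤ)) / 2 = k := by omega
    rw [i1, i2, i3, i4]
    have hz : (Polynomial.Chebyshev.S ℝ (k : ℤ)).eval (2 * Real.cos (2 * Real.pi / ((2 * k + 1 : ℕ) : ℝ))) + (Polynomial.Chebyshev.S ℝ ((k : ℤ) - 1)).eval (2 * Real.cos (2 * Real.pi / ((2 * k + 1 : ℕ) : ℝ))) = 0 := by
      have a1 := hS (k - 1)
      have a2 := hS k
      have e : ((k : ℤ) + 1 : ℝ) * (2 * Real.pi / ((2 * k + 1 : ℕ) : ℝ)) = 2 * Real.pi - (((k : ℤ) - 1 : ℤ) + 1 : ℝ) * (2 * Real.pi / ((2 * k + 1 : ℕ) : ℝ)) := by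
        push_cast at hm0 ⊢
        field_simp
        ring
      rw [e, Real.sin_two_pi_sub, ← a1] at a2
      have : ∀ a b : ℝ, a * Real.sin (2 * Real.pi / ((2 * k + 1 : ℕ) : ℝ)) = -(b * Real.sin (2 * Real.pi / ((2 * k + 1 : ℕ) : ℝ))) → a + b = 0 := by
        intro a b h
        have : (a + b) * Real.sin (2 * Real.pi / ((2 * k + 1 : ℕ) : ℝ)) = 0 := by linarith
        exact (mul_eq_zero.mp this).resolve_right hs.ne'
      exact this _ _ a2
    rw [hz]; simp

lemma rf_pow_ne {B : Type*} (M : CoxeterMatrix B) {i j : B} (hij : i ≠ j) {k : ℕ} (hk : 0 < k)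
    (hkm : M i j = 0 ∨ k < M i j) : (rf M i * rf M j) ^ k ≠ 1 := by
  intro h
  have key := Module.reflection_mul_reflection_pow_apply_self (fc_self M i) (fc_self M j) k
    _ (cc_t M i j)
  change ((rf M i * rf M j) ^ k) _ = _ at key
  rw [h] at key
  have ki := DFunLike.congr_fun key i
  have kj := DFunLike.congr_fun key j
  simp [hij, hij.symm, fc_single] at ki kj
  have hS := fun n : ℤ => Polynomial.Chebyshev.S_two_mul_real_cos (2 * Real.pi / (M i j : ℝ)) n
  by_cases h0 : M i j = 0
  · simp [h0, cc] at kj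
    omega
  by_cases h2 : M i j = 2
  · have : k = 1 := by omega
    subst this
    simp [h2] at ki
  have hm := M_ge M hij h0 h2
  have hs := sin_th_pos hm
  have hkm' : k < M i j := by omega
  have hc : cc M i j ≠ 0 := by
    unfold cc
    have hm' : (3 : ℝ) ≤ M i j := by exact_mod_cast hm
    have hp := Real.pi_pos
    have : 0 < Real.cos (Real.pi / M i j) := by
      apply Real.cos_pos_of_mem_Ioo
      constructor
      · have : 0 < Real.pi / M i j := by positivity
        linarith
      · rw [div_lt_iff₀ (by linarith)]; nlinarith
    nlinarith
  have z : (Polynomial.Chebyshev.S ℝ ((k : ℤ) - 1)).eval (2 * Real.cos (2 * Real.pi / (M i j : ℝ))) = 0 := by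
    tauto
  rw [z, add_zero] at ki
  have b1 := hS k
  have b2 := hS (k - 1)
  rw [z, zero_mul] at b2
  rw [← ki, one_mul] at b1
  push_cast at b1 b2
  rw [sub_add_cancel] at b2
  rw [add_mul, one_mul, Real.sin_add, ← b2, zero_mul, zero_add] at b1
  have c1 : Real.cos (k * (2 * Real.pi / (M i j : ℝ))) = 1 := by
    have : (Real.cos (k * (2 * Real.pi / (M i j : ℝ))) - 1) * Real.sin (2 * Real.pi / (M i j : ℝ)) = 0 := by linarith
    linarith [(mul_eq_zero.mp this).resolve_right hs.ne']
  have hp := Real.pi_pos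
  have hmpos : (0 : ℝ) < M i j := by positivity
  have hkpos : (0 : ℝ) < k := by exact_mod_cast hk
  have hkm2 : (k : ℝ) < M i j := by exact_mod_cast hkm'
  have p1 : 0 < k * (2 * Real.pi / (M i j : ℝ)) := by positivity
  have p2 : k * (2 * Real.pi / (M i j : ℝ)) < 2 * Real.pi := by
    rw [mul_div_assoc', div_lt_iff₀ hmpos]; nlinarith
  rw [Real.cos_eq_one_iff_of_lt_of_lt (by linarith) p2] at c1
  linarith

lemma simple_pow_ne {B : Type*} (M : CoxeterMatrix B) {i j : B} (hij : i ≠ j) {k : ℕ} (hk : 0 < k)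
    (hkm : M i j = 0 ∨ k < M i j) :
    (M.toCoxeterSystem.simple i * M.toCoxeterSystem.simple j) ^ k ≠ 1 := by
  intro h
  have hl : M.IsLiftable (rf M) := rf_pow M
  apply rf_pow_ne M hij hk hkm
  have := congrArg (M.toCoxeterSystem.lift ⟨rf M, hl⟩) h
  rwa [map_pow, map_mul, CoxeterSystem.lift_apply_simple _ hl,
    CoxeterSystem.lift_apply_simple _ hl, map_one] at this

section Exchange

variable {B W : Type*} [Group W] {M : CoxeterMatrix B} (cs : CoxeterSystem M W)

open Classical in
/-- The action of a simple reflection on signed group elements. -/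
noncomputable def sgn (i : B) : Equiv.Perm (W × ZMod 2) :=
  Function.Involutive.toPerm
    (fun p => (cs.simple i * p.1 * cs.simple i, p.2 + if p.1 = cs.simple i then 1 else 0)) (by
      rintro ⟨t, e⟩
      have h1 : cs.simple i * t * cs.simple i = cs.simple i ↔ t = cs.simple i := by
        constructor
        · intro h
          have := congrArg (fun x => cs.simple i * x * cs.simple i) h
          simpa [mul_assoc] using this
        · rintro rfl; simp
      ext
      · simp [mul_assoc]
      · simp only [h1]
        split_ifs <;> simp [add_assoc]
        decide)

open Classical in
lemma sgn_apply (i : B) (p : W × ZMod 2) : sgn cs i p =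
    (cs.simple i * p.1 * cs.simple i, p.2 + if p.1 = cs.simple i then 1 else 0) := rfl

lemma simple_mul_pow_comm (i j : B) (n : ℕ) :
    ((cs.simple i * cs.simple j) ^ n)⁻¹ * cs.simple j =
      cs.simple j * (cs.simple i * cs.simple j) ^ n := by
  induction n with
  | zero => simp
  | succ n ih =>
    rw [pow_succ', mul_inv_rev, mul_assoc]
    have : (cs.simple i * cs.simple j)⁻¹ * cs.simple j =
      cs.simple j * (cs.simple i * cs.simple j) := by simp [mul_assoc]
    rw [this, ← mul_assoc, ih, mul_assoc, ← pow_succ, pow_succ']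

open Classical in
lemma sgn_pow (i j : B) (n : ℕ) (p : W × ZMod 2) :
    ((sgn cs i * sgn cs j) ^ n) p =
      ((cs.simple i * cs.simple j) ^ n * p.1 * ((cs.simple i * cs.simple j) ^ n)⁻¹,
        p.2 + ∑ k ∈ Finset.range (2 * n),
          if p.1 = cs.simple j * (cs.simple i * cs.simple j) ^ k then 1 else 0) := by
  induction n with
  | zero => simp
  | succ n ih =>
    rw [pow_succ', Equiv.Perm.mul_apply, ih, Equiv.Perm.mul_apply, sgn_apply, sgn_apply]
    have hx : ∀ x a : W, (cs.simple i * cs.simple j) ^ n * x * ((cs.simple i * cs.simple j) ^ n)⁻¹ = a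
        ↔ x = ((cs.simple i * cs.simple j) ^ n)⁻¹ * a * (cs.simple i * cs.simple j) ^ n := by
      intro x a
      constructor
      · rintro rfl; group
      · rintro rfl; group
    have c1 : (cs.simple i * cs.simple j) ^ n * p.1 * ((cs.simple i * cs.simple j) ^ n)⁻¹ = cs.simple j
        ↔ p.1 = cs.simple j * (cs.simple i * cs.simple j) ^ (2 * n) := by
      rw [hx, simple_mul_pow_comm, mul_assoc, ← pow_add, two_mul]
    have c2 : cs.simple j * ((cs.simple i * cs.simple j) ^ n * p.1 *
        ((cs.simple i * cs.simple j) ^ n)⁻¹) * cs.simple j = cs.simple i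
        ↔ p.1 = cs.simple j * (cs.simple i * cs.simple j) ^ (2 * n + 1) := by
      have : ∀ x : W, cs.simple j * x * cs.simple j = cs.simple i ↔
          x = cs.simple j * (cs.simple i * cs.simple j) := by
        intro x
        constructor
        · intro h
          rw [← h]; simp [mul_assoc]
        · rintro rfl; simp [mul_assoc]
      rw [this, hx, ← mul_assoc, simple_mul_pow_comm, mul_assoc, mul_assoc, ← pow_succ', ← pow_add]
      rw [show n + (n + 1) = 2 * n + 1 by omega]
    ext
    · simp [pow_succ', mul_assoc]
    · rw [show 2 * (n + 1) = 2 * n + 1 + 1 by omega, Finset.sum_range_succ, Finset.sum_range_succ]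
      simp only [c1, c2, add_assoc]

lemma sgn_liftable : M.IsLiftable (sgn cs) := by
  classical
  intro i j
  ext1 p
  rw [sgn_pow, two_mul, Finset.sum_range_add]
  simp only [pow_add, cs.simple_mul_simple_pow, one_mul]
  ext
  · simp
  · simp only [Equiv.Perm.coe_one, id]
    rw [← two_mul, show (2 : ZMod 2) = 0 from rfl, zero_mul, add_zero]

/-- The signed permutation representation. -/
noncomputable def sgnHom : W →* Equiv.Perm (W × ZMod 2) := cs.lift ⟨sgn cs, sgn_liftable cs⟩

open Classical in
lemma sgnHom_wordProd (ω : List B) (t : W) (e : ZMod 2) :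
    sgnHom cs (cs.wordProd ω) (t, e) =
      (cs.wordProd ω * t * (cs.wordProd ω)⁻¹, e + (List.count t (cs.rightInvSeq ω) : ZMod 2)) := by
  induction ω with
  | nil => simp
  | cons i ω ih =>
    rw [cs.wordProd_cons, map_mul, Equiv.Perm.mul_apply, ih, sgnHom, cs.lift_apply_simple, sgn_apply]
    ext
    · simp [mul_assoc]
    · have : cs.wordProd ω * t * (cs.wordProd ω)⁻¹ = cs.simple i ↔
        (cs.wordProd ω)⁻¹ * cs.simple i * cs.wordProd ω = t := by
        constructor
        · intro h; rw [← h]; group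
        · rintro rfl; group
      simp only [CoxeterSystem.rightInvSeq, List.count_cons, this, beq_iff_eq]
      push_cast
      rw [add_assoc]

lemma mem_rightInvSeq_of_descent (ω : List B) (i : B)
    (h : cs.IsRightDescent (cs.wordProd ω) i) : cs.simple i ∈ cs.rightInvSeq ω := by
  classical
  obtain ⟨ω', hr, hw⟩ := cs.exists_isReduced (cs.wordProd ω * cs.simple i)
  have hp : cs.wordProd (ω'.concat i) = cs.wordProd ω := by
    rw [cs.wordProd_concat, ← hw]; simp
  have hl : cs.length (cs.wordProd ω * cs.simple i) + 1 = cs.length (cs.wordProd ω) :=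
    cs.isRightDescent_iff.mp h
  have hr' : cs.IsReduced (ω'.concat i) := by
    unfold CoxeterSystem.IsReduced
    rw [hp, ← hl, hw, hr]; simp
  have h1 := sgnHom_wordProd cs ω (cs.simple i) 0
  have h2 := sgnHom_wordProd cs (ω'.concat i) (cs.simple i) 0
  rw [hp, h1, List.count_eq_one_of_mem hr'.nodup_rightInvSeq
    (by rw [cs.rightInvSeq_concat]; simp)] at h2
  have h3 := congrArg Prod.snd h2
  by_contra hn
  rw [List.count_eq_zero_of_not_mem hn] at h3
  simp at h3

lemma mem_leftInvSeq_of_descent (ω : List B) (i : B)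
    (h : cs.IsLeftDescent (cs.wordProd ω) i) : cs.simple i ∈ cs.leftInvSeq ω := by
  have := mem_rightInvSeq_of_descent cs ω.reverse i
    (by rw [cs.wordProd_reverse]; exact cs.isRightDescent_inv_iff.mpr h)
  rw [cs.rightInvSeq_reverse] at this
  simpa using this

lemma exists_eraseIdx_of_mem (ω : List B) (t : W) (h : t ∈ cs.leftInvSeq ω) :
    ∃ p < ω.length, t * cs.wordProd ω = cs.wordProd (ω.eraseIdx p) := by
  obtain ⟨p, hp, rfl⟩ := List.getElem_of_mem h
  rw [cs.length_leftInvSeq] at hp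
  refine ⟨p, hp, ?_⟩
  rw [← cs.getD_leftInvSeq_mul_wordProd, List.getD_eq_getElem]

lemma leftInvSeq_append (ω ω' : List B) : cs.leftInvSeq (ω ++ ω') =
    cs.leftInvSeq ω ++ (cs.leftInvSeq ω').map (MulAut.conj (cs.wordProd ω)) := by
  induction ω with
  | nil => simp
  | cons i ω ih =>
    simp [CoxeterSystem.leftInvSeq, ih, cs.wordProd_cons]

end Exchange

section Matsumoto

/-- The alternating word `i j i j ⋯` of length `k`, starting with `i`. -/
def altW {B : Type*} (i j : B) : ℕ → List B
  | 0 => []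
  | n + 1 => i :: altW j i n

lemma altW_length {B : Type*} (i j : B) (k : ℕ) : (altW i j k).length = k := by
  induction k generalizing i j with
  | zero => rfl
  | succ k ih => simp [altW, ih]

lemma map_altW {B G : Type*} [Monoid G] (f : B → G) (i j : B) (k : ℕ) :
    ((altW i j k).map f).prod = altProd (f i) (f j) k := by
  induction k generalizing i j with
  | zero => rfl
  | succ k ih => simp [altW, altProd, ih]

lemma map_altProd {G H : Type*} [Monoid G] [Monoid H] (f : G →* H) (a b : G) (k : ℕ) :
    f (altProd a b k) = altProd (f a) (f b) k := by
  induction k generalizing a b with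
  | zero => simp [altProd]
  | succ k ih => simp [altProd, ih]

lemma altProd_mul_inv {G : Type*} [Group G] (a b : G) (hb : b⁻¹ = b) (ha : a⁻¹ = a) (k : ℕ) :
    altProd a b k * (altProd b a k)⁻¹ = (a * b) ^ k := by
  induction k generalizing a b with
  | zero => simp [altProd]
  | succ k ih =>
    have h : altProd a b (k + 1) * (altProd b a (k + 1))⁻¹ =
      a * (altProd b a k * (altProd a b k)⁻¹) * b := by
      simp [altProd, hb, mul_assoc]
    rw [h, ih b a ha hb]
    clear h ih
    induction k with
    | zero => simp
    | succ k ih =>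
      rw [pow_succ, pow_succ, ← ih]
      simp [mul_assoc]

variable {B : Type*} (M : CoxeterMatrix B)

local notation "cs" => CoxeterMatrix.toCoxeterSystem M

lemma mem_leftInvSeq_altW (i j : B) (k : ℕ) (x : M.Group) (h : x ∈ (cs).leftInvSeq (altW j i k)) :
    ∃ p < k, x = (cs).simple j * ((cs).simple i * (cs).simple j) ^ p := by
  induction k generalizing i j x with
  | zero => simp [altW] at h
  | succ k ih =>
    rw [altW, CoxeterSystem.leftInvSeq, List.mem_cons, List.mem_map] at h
    rcases h with rfl | ⟨y, hy, rfl⟩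
    · exact ⟨0, by omega, by simp⟩
    · obtain ⟨p, hp, rfl⟩ := ih j i y hy
      refine ⟨p + 1, by omega, ?_⟩
      rw [MulAut.conj_apply, (cs).inv_simple]
      clear hy hp
      rw [mul_assoc]
      congr 1
      induction p with
      | zero => simp
      | succ p ih2 =>
        rw [pow_succ _ (p + 1), ← ih2, pow_succ]
        simp only [mul_assoc]

/-- Every element with two distinct left descents `i`, `j` has a reduced word beginning with the
alternating word in `i`, `j` of any admissible length. -/
lemma exists_reduced_alt (w : M.Group) (k : ℕ) (i j : B) (hij : i ≠ j)
    (hi : (cs).IsLeftDescent w i) (hj : (cs).IsLeftDescent w j)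
    (hk : M i j = 0 ∨ k ≤ M i j) :
    ∃ u : List B, (cs).IsReduced (altW i j k ++ u) ∧ (cs).wordProd (altW i j k ++ u) = w := by
  induction k generalizing i j with
  | zero =>
    obtain ⟨u, hu, rfl⟩ := (cs).exists_isReduced w
    exact ⟨u, hu, rfl⟩
  | succ k ih =>
    obtain ⟨u, hu, hw⟩ := ih j i hij.symm hj hi (by rw [M.symmetric j i]; omega)
    have hm := mem_leftInvSeq_of_descent (cs) (altW j i k ++ u) i (by rw [hw]; exact hi)
    rw [leftInvSeq_append, List.mem_append] at hm
    rcases hm with hm | hm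
    · exfalso
      obtain ⟨p, hp, hx⟩ := mem_leftInvSeq_altW M i j k _ hm
      apply simple_pow_ne M hij (k := p + 1) (by omega) (by omega)
      rw [pow_succ', mul_assoc, ← hx]
      exact (cs).simple_mul_simple_self i
    · obtain ⟨y, hy, hyi⟩ := List.mem_map.mp hm
      obtain ⟨q, hq, hqe⟩ := exists_eraseIdx_of_mem (cs) u y hy
      have hprod : (cs).wordProd (altW i j (k + 1) ++ u.eraseIdx q) = w := by
        rw [altW, List.cons_append, (cs).wordProd_cons, (cs).wordProd_append, ← hqe, ← hw, ← hyi,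
          (cs).wordProd_append, MulAut.conj_apply]
        have hs : (cs).simple i * (cs).simple i = 1 := (cs).simple_mul_simple_self i
        rw [← hyi, MulAut.conj_apply] at hs
        calc _ = ((cs).wordProd (altW j i k) * y * ((cs).wordProd (altW j i k))⁻¹ *
              ((cs).wordProd (altW j i k) * y * ((cs).wordProd (altW j i k))⁻¹)) *
              ((cs).wordProd (altW j i k) * (cs).wordProd u) := by group
          _ = _ := by rw [hs, one_mul]
      refine ⟨u.eraseIdx q, ?_, hprod⟩
      unfold CoxeterSystem.IsReduced at hu ⊢
      rw [hprod, ← hw, hu]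
      simp [altW_length, List.length_eraseIdx_of_lt hq]
      omega

lemma artin_rel (i j : B) (h : M i j ≠ 0) :
    altProd (σ M i) (σ M j) (M i j) = altProd (σ M j) (σ M i) (M i j) := by
  have := PresentedGroup.mk_eq_mk_of_mul_inv_mem (rels := artinRelationsSet M)
    (x := altProd (FreeGroup.of i) (FreeGroup.of j) (M i j))
    (y := altProd (FreeGroup.of j) (FreeGroup.of i) (M i j)) ⟨i, j, h, rfl⟩
  rw [map_altProd, map_altProd] at this
  exact this

/-- Product of a positive word in the Artin group. -/
def P (ω : List B) : ArtinGroup M := (ω.map (σ M)).prod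

lemma P_cons (i : B) (ω : List B) : P M (i :: ω) = σ M i * P M ω := by simp [P]

lemma P_append (ω ω' : List B) : P M (ω ++ ω') = P M ω * P M ω' := by simp [P]

lemma isReduced_tail {i : B} {u : List B} (h : (cs).IsReduced (i :: u)) : (cs).IsReduced u := by
  simpa using h.drop 1

lemma descent_cons {i : B} {u : List B} (h : (cs).IsReduced (i :: u)) :
    (cs).IsLeftDescent ((cs).wordProd (i :: u)) i := by
  unfold CoxeterSystem.IsLeftDescent
  rw [h.eq, (cs).wordProd_cons, (cs).simple_mul_simple_cancel_left, (isReduced_tail M h).eq]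
  simp

lemma wordProd_altW (i j : B) (h : M i j ≠ 0) :
    (cs).wordProd (altW i j (M i j)) = (cs).wordProd (altW j i (M i j)) := by
  rw [CoxeterSystem.wordProd, CoxeterSystem.wordProd, map_altW, map_altW, ← mul_inv_eq_one,
    altProd_mul_inv _ _ ((cs).inv_simple j) ((cs).inv_simple i), (cs).simple_mul_simple_pow]

/-- Matsumoto's theorem. -/
theorem matsumoto (n : ℕ) (ω ω' : List B) (hn : ω.length = n) (hr : (cs).IsReduced ω)
    (hr' : (cs).IsReduced ω') (h : (cs).wordProd ω = (cs).wordProd ω') : P M ω = P M ω' := by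
  induction n generalizing ω ω' with
  | zero =>
    have : ω'.length = 0 := by rw [← hr'.eq, ← h, hr.eq, hn]
    rw [List.length_eq_zero_iff] at hn this
    rw [hn, this]
  | succ n ih =>
    have hn' : ω'.length = n + 1 := by rw [← hr'.eq, ← h, hr.eq, hn]
    have same : ∀ (i : B) (u v : List B), (i :: u).length = n + 1 → (cs).IsReduced (i :: u) →
        (cs).IsReduced (i :: v) → (cs).wordProd (i :: u) = (cs).wordProd (i :: v) →
        P M (i :: u) = P M (i :: v) := by
      intro i u v hl h1 h2 h3
      rw [P_cons, P_cons, ih u v (by simpa using hl) (isReduced_tail M h1) (isReduced_tail M h2)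
        (by simpa [(cs).wordProd_cons] using h3)]
    rcases ω with _ | ⟨i, u⟩
    · simp at hn
    rcases ω' with _ | ⟨j, v⟩
    · simp at hn'
    by_cases hij : i = j
    · subst hij
      exact same i u v hn hr hr' h
    have di := descent_cons M hr
    have dj := descent_cons M hr'
    rw [← h] at dj
    by_cases h0 : M i j = 0
    · obtain ⟨x, hx, hxw⟩ := exists_reduced_alt M _ (n + 2) i j hij di dj (Or.inl h0)
      have := hx.eq
      rw [hxw, hr.eq, hn, List.length_append, altW_length] at this
      omega
    obtain ⟨x, hx, hxw⟩ := exists_reduced_alt M _ (M i j) i j hij di dj (Or.inr le_rfl)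
    have e : (cs).wordProd (altW j i (M i j) ++ x) = (cs).wordProd (altW i j (M i j) ++ x) := by
      rw [(cs).wordProd_append, (cs).wordProd_append, wordProd_altW M i j h0]
    have hx' : (cs).IsReduced (altW j i (M i j) ++ x) := by
      unfold CoxeterSystem.IsReduced at hx ⊢
      rw [e, hx, List.length_append, List.length_append, altW_length, altW_length]
    have eP : P M (altW i j (M i j) ++ x) = P M (altW j i (M i j) ++ x) := by
      have e3 : P M (altW i j (M i j)) = P M (altW j i (M i j)) := by
        unfold P
        rw [map_altW, map_altW, artin_rel M i j h0]
      rw [P_append, P_append, e3]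
    obtain ⟨m, hm⟩ := Nat.exists_eq_succ_of_ne_zero h0
    rw [hm] at hx hx' e eP hxw
    have a1 := same i u (altW j i m ++ x) hn hr hx hxw.symm
    have a2 := same j v (altW i j m ++ x) hn' hr' hx' (by rw [← h, ← hxw]; exact e.symm)
    rw [a1, a2]
    exact eP

/-- The canonical positive lift. -/
noncomputable def τ (w : M.Group) : ArtinGroup M := P M ((cs).exists_isReduced w).choose

lemma τ_eq (ω : List B) (h : (cs).IsReduced ω) : τ M ((cs).wordProd ω) = P M ω := by
  have hs := ((cs).exists_isReduced ((cs).wordProd ω)).choose_spec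
  exact matsumoto M _ _ _ rfl hs.1 h hs.2.symm

lemma τ_left (i : B) (w : M.Group) (h : (cs).length ((cs).simple i * w) = (cs).length w + 1) :
    τ M ((cs).simple i * w) = σ M i * τ M w := by
  obtain ⟨ω, hr, rfl⟩ := (cs).exists_isReduced w
  rw [← (cs).wordProd_cons] at h ⊢
  rw [τ_eq M ω hr, τ_eq M (i :: ω) (by unfold CoxeterSystem.IsReduced; rw [h, hr.eq]; simp), P_cons]

lemma τ_right (i : B) (w : M.Group) (h : (cs).length (w * (cs).simple i) = (cs).length w + 1) :
    τ M (w * (cs).simple i) = τ M w * σ M i := by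
  obtain ⟨ω, hr, rfl⟩ := (cs).exists_isReduced w
  rw [← (cs).wordProd_concat] at h ⊢
  rw [τ_eq M ω hr, τ_eq M (ω.concat i) (by unfold CoxeterSystem.IsReduced; rw [h, hr.eq]; simp)]
  simp [P]

lemma τ_conj (v : M.Group) (y z : B) (h : (cs).simple y * v = v * (cs).simple z) :
    σ M y * τ M v = τ M v * σ M z := by
  rcases (cs).length_simple_mul v y with hl | hl
  · rw [← τ_left M y v hl, h, ← τ_right M z v (by rw [← h]; exact hl)]
  · have h1 := τ_left M y ((cs).simple y * v)
      (by rw [(cs).simple_mul_simple_cancel_left, hl])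
    have h2 := τ_right M z (v * (cs).simple z)
      (by rw [(cs).simple_mul_simple_cancel_right, ← h, hl])
    rw [(cs).simple_mul_simple_cancel_left] at h1
    rw [(cs).simple_mul_simple_cancel_right, ← h] at h2
    calc σ M y * τ M v = σ M y * (τ M ((cs).simple y * v) * σ M z) := by rw [← h2]
      _ = _ := by rw [← mul_assoc, ← h1]

/-- The projection of the Artin group onto the Coxeter group. -/
def toW : ArtinGroup M →* M.Group :=
  PresentedGroup.toGroup (f := M.simple) (by
    rintro r ⟨i, j, h, rfl⟩
    rw [map_mul, map_inv, map_altProd, map_altProd, FreeGroup.lift_apply_of,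
      FreeGroup.lift_apply_of]
    have e := altProd_mul_inv _ _ ((cs).inv_simple j) ((cs).inv_simple i) (M i j)
    rw [(cs).simple_mul_simple_pow i j] at e
    exact e)

lemma toW_σ (i : B) : toW M (σ M i) = M.simple i := by
  simp [toW, σ]

lemma toW_P (ω : List B) : toW M (P M ω) = (cs).wordProd ω := by
  induction ω with
  | nil => simp [P]
  | cons i ω ih => rw [P_cons, map_mul, ih, toW_σ, (cs).wordProd_cons]; rfl

lemma toW_τ (w : M.Group) : toW M (τ M w) = w := by
  obtain ⟨ω, hr, rfl⟩ := (cs).exists_isReduced w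
  rw [τ_eq M ω hr, toW_P]

lemma exists_reduced_in (X : Set B) (ω : List B) (h : ∀ i ∈ ω, i ∈ X) :
    ∃ ω' : List B, (∀ i ∈ ω', i ∈ X) ∧ (cs).IsReduced ω' ∧
      (cs).wordProd ω' = (cs).wordProd ω := by
  induction ω with
  | nil => exact ⟨[], by simp, by simp [CoxeterSystem.IsReduced], rfl⟩
  | cons i ω ih =>
    obtain ⟨u, huX, hur, hup⟩ := ih (fun j hj => h j (List.mem_cons_of_mem _ hj))
    rcases (cs).length_simple_mul ((cs).wordProd u) i with hl | hl
    · refine ⟨i :: u, ?_, ?_, ?_⟩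
      · intro j hj
        rcases List.mem_cons.mp hj with rfl | hj
        · exact h _ (by simp)
        · exact huX j hj
      · unfold CoxeterSystem.IsReduced
        rw [(cs).wordProd_cons, hl, hur.eq]; simp
      · rw [(cs).wordProd_cons, (cs).wordProd_cons, hup]
    · have hm := mem_leftInvSeq_of_descent (cs) u i (by
        unfold CoxeterSystem.IsLeftDescent; omega)
      obtain ⟨p, hp, he⟩ := exists_eraseIdx_of_mem (cs) u _ hm
      refine ⟨u.eraseIdx p, fun j hj => huX j (List.mem_of_mem_eraseIdx hj), ?_, ?_⟩
      · unfold CoxeterSystem.IsReduced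
        rw [← he, List.length_eraseIdx_of_lt hp]
        rw [hur.eq] at hl
        omega
      · rw [← he, hup, (cs).wordProd_cons]

lemma exists_word_in (X : Set B) (v : M.Group) (hv : v ∈ WP M X) :
    ∃ ω : List B, (∀ i ∈ ω, i ∈ X) ∧ (cs).wordProd ω = v := by
  unfold WP at hv
  induction hv using Subgroup.closure_induction with
  | mem x hx =>
    obtain ⟨i, hi, rfl⟩ := hx
    exact ⟨[i], by simpa using hi, by simp⟩
  | one => exact ⟨[], by simp, by simp⟩
  | mul x y _ _ hx hy =>
    obtain ⟨a, ha, rfl⟩ := hx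
    obtain ⟨b, hb, rfl⟩ := hy
    refine ⟨a ++ b, ?_, (cs).wordProd_append a b⟩
    intro i hi
    rcases List.mem_append.mp hi with hi | hi
    · exact ha i hi
    · exact hb i hi
  | inv x _ hx =>
    obtain ⟨a, ha, rfl⟩ := hx
    exact ⟨a.reverse, by simpa using ha, (cs).wordProd_reverse a⟩

lemma τ_mem (X : Set B) (v : M.Group) (hv : v ∈ WP M X) : τ M v ∈ AP M X := by
  obtain ⟨ω, hω, rfl⟩ := exists_word_in M X v hv
  obtain ⟨u, hu, hr, hp⟩ := exists_reduced_in M X ω hω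
  rw [← hp, τ_eq M u hr, P]
  apply Subgroup.list_prod_mem
  intro x hx
  obtain ⟨i, hi, rfl⟩ := List.mem_map.mp hx
  exact Subgroup.subset_closure ⟨i, hu i hi, rfl⟩

lemma toW_mem (X : Set B) (g : ArtinGroup M) (hg : g ∈ AP M X) : toW M g ∈ WP M X := by
  unfold AP at hg
  induction hg using Subgroup.closure_induction with
  | mem x hx =>
    obtain ⟨i, hi, rfl⟩ := hx
    rw [toW_σ]
    exact Subgroup.subset_closure ⟨i, hi, rfl⟩
  | one => rw [map_one]; exact one_mem _
  | mul x y _ _ hx hy => rw [map_mul]; exact mul_mem hx hy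
  | inv x _ hx => rw [map_inv]; exact inv_mem hx

lemma τ_conj' (v : M.Group) (y z : B) (h : v⁻¹ * M.simple y * v = M.simple z) :
    (τ M v)⁻¹ * σ M y * τ M v = σ M z := by
  rw [mul_assoc, τ_conj M v y z ?_, inv_mul_cancel_left]
  change M.simple y * v = v * M.simple z
  rw [← h]; group

end Matsumoto

/-- Proposition 2 of the paper: Property `⋆_W` for `(W_X, W_S)` is equivalent to
Property `⋆_A` for `(A_X, A_S)`. -/
theorem starW_iff_starA
    {B : Type*} [Finite B] (M : CoxeterMatrix B)
    (X : Set B) (hX : X.Nonempty) (hXproper : X ≠ Set.univ) :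
    StarW M X ↔ StarA M X := by
  constructor
  · intro hW Y₁ Y₂ h₁ h₂ g hg
    have key : ∀ y ∈ Y₁, ∃ z ∈ Y₂, g⁻¹ * σ M y * g = σ M z := by
      intro y hy
      have : g⁻¹ * σ M y * g ∈ σ M '' Y₂ := by
        rw [← hg]; exact ⟨_, ⟨y, hy, rfl⟩, rfl⟩
      obtain ⟨z, hz, h⟩ := this
      exact ⟨z, hz, h.symm⟩
    have hproj : ∀ y, toW M (g⁻¹ * σ M y * g) = (toW M g)⁻¹ * M.simple y * toW M g := by
      intro y; simp [toW_σ]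
    obtain ⟨v, hv, hvy⟩ := hW Y₁ Y₂ h₁ h₂ (toW M g) (by
      have := congrArg (fun s => toW M '' s) hg
      simp only [Set.image_image, hproj, toW_σ] at this ⊢
      exact this)
    refine ⟨τ M v, τ_mem M X v hv, fun y hy => ?_⟩
    obtain ⟨z, hz, h⟩ := key y hy
    rw [h]
    apply τ_conj'
    rw [hvy y hy, ← hproj, h, toW_σ]
  · intro hA Y₁ Y₂ h₁ h₂ w hw
    have hproj : ∀ (g : ArtinGroup M) y,
        toW M (g⁻¹ * σ M y * g) = (toW M g)⁻¹ * M.simple y * toW M g := by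
      intro g y; simp [toW_σ]
    obtain ⟨h, hh, hy⟩ := hA Y₁ Y₂ h₁ h₂ (τ M w) (by
      ext x
      constructor
      · rintro ⟨_, ⟨y, hy, rfl⟩, rfl⟩
        have : w⁻¹ * M.simple y * w ∈ M.simple '' Y₂ := by
          rw [← hw]; exact ⟨_, ⟨y, hy, rfl⟩, rfl⟩
        obtain ⟨z, hz, e⟩ := this
        exact ⟨z, hz, (τ_conj' M w y z e.symm).symm⟩
      · rintro ⟨z, hz, rfl⟩
        have : M.simple z ∈ (fun x => w⁻¹ * x * w) '' (M.simple '' Y₁) := by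
          rw [hw]; exact ⟨z, hz, rfl⟩
        obtain ⟨_, ⟨y, hy, rfl⟩, e⟩ := this
        exact ⟨_, ⟨y, hy, rfl⟩, τ_conj' M w y z e⟩)
    refine ⟨toW M h, toW_mem M X h hh, fun y hyY => ?_⟩
    rw [← hproj, hy y hyY, hproj, toW_τ]

end ArtinTits
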